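/- (Extended Krasnosel'skiĭ–Mann theorem.) Let n be a positive integer, let D be a nonempty closed convex subset of ℝ^n, let ε ∈ (0,1), let {η^k}_{k∈ℕ} be a summable sequence in [0,∞), and let {Λ^k}_{k∈ℕ} be a sequence of self-adjoint positive-definite linear operators on ℝ^n such that for all k ∈ ℕ: φ^k·Id ⪰ Λ^k ⪰ θ^k·Id with φ^k, θ^k ∈ [ε, 1−ε], and (1+η^k)·Λ^{k+1} ⪰ Λ^k. Let R : D → D be a nonexpansive operator whose fixed-point set Fix R is nonempty. Let x^0 ∈ D and define the sequence x^{k+1} := x^k + Λ^k(R(x^k) − x^k), assuming x^k ∈ D for all k. Then {x^k} converges to a point in Fix R. -/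

import Mathlib

open scoped RealInnerProductSpace

section QuasiFejer

open Filter Topology

/-- Partial products of `1 + η` for summable `η ≥ 0` are bounded. -/
lemma exists_bounded_partial_prod {η : ℕ → ℝ} (hη0 : ∀ k, 0 ≤ η k) (hη : Summable η) :
    ∃ (P : ℕ → ℝ) (C : ℝ), (∀ k, 1 ≤ P k) ∧ (∀ k, P k ≤ C) ∧
      ∀ k, P (k + 1) = (1 + η k) * P k := by
  refine ⟨fun k => ∏ j ∈ Finset.range k, (1 + η j), Real.exp (∑' j, η j), fun k => ?_,
    fun k => ?_, fun k => ?_⟩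
  · exact Finset.prod_induction _ (fun t : ℝ => 1 ≤ t) (fun _ _ => one_le_mul_of_one_le_of_one_le)
      le_rfl fun j _ => by linarith [hη0 j]
  · calc ∏ j ∈ Finset.range k, (1 + η j) ≤ ∏ j ∈ Finset.range k, Real.exp (η j) :=
          Finset.prod_le_prod (fun j _ => by linarith [hη0 j])
            fun j _ => by linarith [Real.add_one_le_exp (η j)]
      _ = Real.exp (∑ j ∈ Finset.range k, η j) := (Real.exp_sum _ _).symm
      _ ≤ _ := Real.exp_le_exp.2 (hη.sum_le_tsum _ fun j _ => hη0 j)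
  · simp only [Finset.prod_range_succ, mul_comm]

/-- A nonnegative sequence with `a (k + 1) ≤ (1 + η k) * (a k - b k)`, where `b ≥ 0` and `η ≥ 0` is
summable, is bounded, `b` tends to zero, and `a` tends to zero as soon as a subsequence does. -/
lemma quasi_fejer {η a b : ℕ → ℝ} (hη0 : ∀ k, 0 ≤ η k) (hη : Summable η)
    (ha : ∀ k, 0 ≤ a k) (hb : ∀ k, 0 ≤ b k)
    (hab : ∀ k, a (k + 1) ≤ (1 + η k) * (a k - b k)) :
    (∃ M, ∀ k, a k ≤ M) ∧ Tendsto b atTop (𝓝 0) ∧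
      ∀ s : ℕ → ℕ, StrictMono s → Tendsto (a ∘ s) atTop (𝓝 0) → Tendsto a atTop (𝓝 0) := by
  obtain ⟨P, C, hP1, hPC, hP⟩ := exists_bounded_partial_prod hη0 hη
  have hP0 : ∀ k, 0 < P k := fun k => one_pos.trans_le (hP1 k)
  have hstep : ∀ k, b k / P k ≤ a k / P k - a (k + 1) / P (k + 1) := by
    intro k
    have h1 : 0 < 1 + η k := by linarith [hη0 k]
    have h2 : a (k + 1) / P (k + 1) ≤ (a k - b k) / P k := by
      rw [hP, ← mul_div_mul_left (a k - b k) (P k) h1.ne']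
      exact div_le_div_of_nonneg_right (hab k) (mul_pos h1 (hP0 k)).le
    rw [sub_div] at h2
    linarith
  have hanti : Antitone fun k => a k / P k := antitone_nat_of_succ_le fun k => by
    linarith [hstep k, div_nonneg (hb k) (hP0 k).le]
  have hA0 : ∀ k, 0 ≤ a k / P k := fun k => div_nonneg (ha k) (hP0 k).le
  have hle : ∀ {t : ℝ} (k), 0 ≤ t → t ≤ C * (t / P k) := fun {t} k ht => by
    rw [← mul_div_assoc, le_div_iff₀ (hP0 k), mul_comm C]
    exact mul_le_mul_of_nonneg_left (hPC k) ht
  have hC : 0 ≤ C := (hP0 0).le.trans (hPC 0)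
  have hlim := tendsto_atTop_ciInf hanti ⟨0, by rintro _ ⟨k, rfl⟩; exact hA0 k⟩
  refine ⟨⟨C * (a 0 / P 0), fun k => (hle k (ha k)).trans
    (mul_le_mul_of_nonneg_left (hanti (Nat.zero_le k)) hC)⟩, ?_, fun s hs h0 => ?_⟩
  · have hd := (hlim.sub (hlim.comp (tendsto_add_atTop_nat 1))).const_mul C
    rw [sub_self, mul_zero] at hd
    exact squeeze_zero hb (fun k => (hle k (hb k)).trans
      (mul_le_mul_of_nonneg_left (hstep k) hC)) hd
  · have hs0 : Tendsto ((fun k => a k / P k) ∘ s) atTop (𝓝 0) :=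
      squeeze_zero (fun k => hA0 _) (fun k => div_le_self (ha _) (hP1 _)) h0
    have h := (tendsto_nhds_unique (hlim.comp hs.tendsto_atTop) hs0) ▸ hlim
    have h' := h.const_mul C
    rw [mul_zero] at h'
    exact squeeze_zero ha (fun k => hle k (ha k)) h'

end QuasiFejer

section InverseForm

variable {E : Type*} [NormedAddCommGroup E] [InnerProductSpace ℝ E]

/-- A coercive endomorphism of a finite-dimensional space has a right inverse. -/
lemma exists_rightInverse_of_coercive [FiniteDimensional ℝ E] {A : E →ₗ[ℝ] E} {ε : ℝ} (hε : 0 < ε)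
    (hlow : ∀ z, ε * ‖z‖ ^ 2 ≤ ⟪A z, z⟫) : ∃ S : E → E, ∀ z, A (S z) = z := by
  have hinj : Function.Injective A := (injective_iff_map_eq_zero A).2 fun z hz => by
    have h := hlow z
    rw [hz, inner_zero_left] at h
    have : ‖z‖ ^ 2 ≤ 0 := by nlinarith
    simpa using le_antisymm this (sq_nonneg _)
  exact (LinearMap.injective_iff_surjective.1 hinj).hasRightInverse

/-- The quadratic form of the inverse is bounded above if the form of `A` is coercive. -/
lemma inner_preimage_le {A : E →ₗ[ℝ] E} {ε : ℝ} (hε : 0 < ε)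
    (hlow : ∀ z, ε * ‖z‖ ^ 2 ≤ ⟪A z, z⟫) (u : E) : ⟪u, A u⟫ ≤ ‖A u‖ ^ 2 / ε := by
  have h1 := hlow u
  have h2 := real_inner_le_norm (A u) u
  rw [real_inner_comm, le_div_iff₀ hε]
  nlinarith [sq_nonneg (ε * ‖u‖ - ‖A u‖)]

/-- The quadratic form of the inverse dominates the squared norm if `0 ≤ A ≤ 1`. -/
lemma norm_sq_le_inner_preimage {A : E →ₗ[ℝ] E} (hsa : ∀ z w, ⟪A z, w⟫ = ⟪z, A w⟫)
    (hpos : ∀ z, 0 ≤ ⟪A z, z⟫) (hup : ∀ z, ⟪A z, z⟫ ≤ ‖z‖ ^ 2) (u : E) :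
    ‖A u‖ ^ 2 ≤ ⟪u, A u⟫ := by
  have h1 := hpos (u - A u)
  have h2 := hup (A u)
  have h3 : ⟪A (A u), u⟫ = ⟪A u, A u⟫ := hsa _ _
  rw [map_sub, inner_sub_left, inner_sub_right, inner_sub_right, h3, real_inner_comm,
    real_inner_self_eq_norm_sq] at h1
  linarith

/-- Inversion reverses the Loewner order: from `A ≤ c B` one gets `B⁻¹ ≤ c A⁻¹`. -/
lemma inner_preimage_antitone {A B : E →ₗ[ℝ] E} {c : ℝ} (hc : 0 < c)
    (hsa : ∀ z w, ⟪A z, w⟫ = ⟪z, A w⟫) (hpos : ∀ z, 0 ≤ ⟪A z, z⟫)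
    (hAB : ∀ z, ⟪A z, z⟫ ≤ c * ⟪B z, z⟫) {u w : E} (h : B u = A w) :
    ⟪u, B u⟫ ≤ c * ⟪w, A w⟫ := by
  have h1 := hpos (c • w - u)
  have h2 := hAB u
  rw [h, real_inner_comm u (A w)] at h2
  rw [map_sub, map_smul, inner_sub_left, inner_sub_right, inner_sub_right, inner_smul_left,
    inner_smul_left, inner_smul_right, inner_smul_right, hsa u w, real_inner_comm u (A w),
    real_inner_comm w (A w)] at h1
  simp only [conj_trivial] at h1
  rw [h]
  refine le_of_mul_le_mul_left ?_ hc
  linarith [real_inner_comm u (A w), real_inner_comm w (A w)]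

/-- One step of the relaxed iteration decreases the quadratic form of the inverse relaxation. -/
lemma inner_preimage_step_le {A : E →ₗ[ℝ] E} {ε : ℝ} (hsa : ∀ z w, ⟪A z, w⟫ = ⟪z, A w⟫)
    (hup : ∀ z, ⟪A z, z⟫ ≤ (1 - ε) * ‖z‖ ^ 2) {u r : E} (h : ‖A u + r‖ ≤ ‖A u‖) :
    ⟪u + r, A (u + r)⟫ ≤ ⟪u, A u⟫ - ε * ‖r‖ ^ 2 := by
  have h1 := pow_le_pow_left₀ (norm_nonneg _) h 2
  rw [norm_add_sq_real] at h1
  have h2 := hup r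
  rw [map_add, inner_add_left, inner_add_right, inner_add_right, ← hsa u r, ← hsa r r,
    real_inner_comm (A u) r]
  linarith

end InverseForm

/-- **Extended Krasnosel'skiĭ–Mann theorem.** Let `D ⊆ ℝ^n` be nonempty,
closed and convex, `{η^k}` a summable sequence in `[0,∞)`, and `{Λ^k}` a sequence of
self-adjoint positive-definite operators with `ε·Id ⪯ θ^k·Id ⪯ Λ^k ⪯ φ^k·Id ⪯ (1-ε)·Id`
and `(1+η^k)·Λ^{k+1} ⪰ Λ^k`.  If `R : D → D` is nonexpansive with `Fix R ≠ ∅`, then the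
iterates `x^{k+1} = x^k + Λ^k (R(x^k) - x^k)` converge to a point of `Fix R`. -/
theorem statement7
    (n : ℕ) (hn : 0 < n)
    (D : Set (EuclideanSpace ℝ (Fin n))) (hD : D.Nonempty)
    (hDclosed : IsClosed D) (hDconvex : Convex ℝ D)
    (ε : ℝ) (hε : ε ∈ Set.Ioo (0 : ℝ) 1)
    (η : ℕ → ℝ) (hη0 : ∀ k, 0 ≤ η k) (hηsum : Summable η)
    (Λ : ℕ → (EuclideanSpace ℝ (Fin n) →ₗ[ℝ] EuclideanSpace ℝ (Fin n)))
    (θ φ : ℕ → ℝ)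
    (hθ : ∀ k, θ k ∈ Set.Icc ε (1 - ε)) (hφ : ∀ k, φ k ∈ Set.Icc ε (1 - ε))
    (hΛsa : ∀ k, ∀ z w, ⟪Λ k z, w⟫ = ⟪z, Λ k w⟫)
    (hΛlow : ∀ k, ∀ z, θ k * ‖z‖ ^ 2 ≤ ⟪Λ k z, z⟫)
    (hΛup : ∀ k, ∀ z, ⟪Λ k z, z⟫ ≤ φ k * ‖z‖ ^ 2)
    (hΛmono : ∀ k, ∀ z, ⟪Λ k z, z⟫ ≤ (1 + η k) * ⟪Λ (k + 1) z, z⟫)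
    (R : EuclideanSpace ℝ (Fin n) → EuclideanSpace ℝ (Fin n))
    (hRD : ∀ x ∈ D, R x ∈ D)
    (hR : ∀ x ∈ D, ∀ y ∈ D, ‖R x - R y‖ ≤ ‖x - y‖)
    (hfixne : ∃ y ∈ D, R y = y)
    (x : ℕ → EuclideanSpace ℝ (Fin n)) (hx0 : x 0 ∈ D) (hxD : ∀ k, x k ∈ D)
    (hrec : ∀ k, x (k + 1) = x k + Λ k (R (x k) - x k)) :
    ∃ p : EuclideanSpace ℝ (Fin n), p ∈ D ∧ R p = p ∧
      Filter.Tendsto x Filter.atTop (nhds p) := by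
  obtain ⟨hε0, -⟩ := hε
  have hlow : ∀ k z, ε * ‖z‖ ^ 2 ≤ ⟪Λ k z, z⟫ := fun k z =>
    (mul_le_mul_of_nonneg_right (hθ k).1 (sq_nonneg _)).trans (hΛlow k z)
  have hup : ∀ k z, ⟪Λ k z, z⟫ ≤ (1 - ε) * ‖z‖ ^ 2 := fun k z =>
    (hΛup k z).trans (mul_le_mul_of_nonneg_right (hφ k).2 (sq_nonneg _))
  have hpos : ∀ k z, 0 ≤ ⟪Λ k z, z⟫ := fun k z => (by positivity : 0 ≤ ε * ‖z‖ ^ 2).trans (hlow k z)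
  choose S hS using fun k => exists_rightInverse_of_coercive hε0 (hlow k)
  have hSlow : ∀ k z, ‖z‖ ^ 2 ≤ ⟪S k z, z⟫ := fun k z => by
    have h := norm_sq_le_inner_preimage (hΛsa k) (hpos k)
      (fun z => (hup k z).trans (by nlinarith [sq_nonneg ‖z‖])) (S k z)
    rwa [hS] at h
  have hSup : ∀ k z, ⟪S k z, z⟫ ≤ ‖z‖ ^ 2 / ε := fun k z => by
    have h := inner_preimage_le hε0 (hlow k) (S k z)
    rwa [hS] at h
  have hfejer : ∀ y ∈ D, R y = y → ∀ k, ⟪S (k + 1) (x (k + 1) - y), x (k + 1) - y⟫ ≤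
      (1 + η k) * (⟪S k (x k - y), x k - y⟫ - ε * ‖R (x k) - x k‖ ^ 2) := by
    intro y hy hRy k
    have hnext : Λ k (S k (x k - y) + (R (x k) - x k)) = x (k + 1) - y := by
      rw [map_add, hS, hrec]; abel
    have hmono := inner_preimage_antitone (by linarith [hη0 k]) (hΛsa k) (hpos k) (hΛmono k)
      ((hS (k + 1) (x (k + 1) - y)).trans hnext.symm)
    have hdec := inner_preimage_step_le (hΛsa k) (hup k) (u := S k (x k - y)) (r := R (x k) - x k)
      (by
        have h := hR _ (hxD k) y hy
        rw [hRy] at h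
        rwa [hS, sub_add_sub_cancel'])
    rw [hS] at hmono hdec
    exact hmono.trans (mul_le_mul_of_nonneg_left hdec (by linarith [hη0 k]))
  have hquasi := fun y hy hRy => quasi_fejer hη0 hηsum
    (fun k => (sq_nonneg _).trans (hSlow k (x k - y))) (fun k => by positivity) (hfejer y hy hRy)
  obtain ⟨y, hy, hRy⟩ := hfixne
  obtain ⟨⟨M, hM⟩, hres, -⟩ := hquasi y hy hRy
  have hbdd : ∀ k, x k ∈ Metric.closedBall y √M := fun k => by
    rw [mem_closedBall_iff_norm]
    exact Real.le_sqrt_of_sq_le ((hSlow k _).trans (hM k))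
  obtain ⟨p, -, s, hs, hsp⟩ := (isCompact_closedBall y √M).tendsto_subseq hbdd
  have hpD : p ∈ D := hDclosed.mem_of_tendsto hsp (.of_forall fun k => hxD _)
  have hres' : Filter.Tendsto (fun k => R (x k) - x k) Filter.atTop (nhds 0) := by
    rw [tendsto_zero_iff_norm_tendsto_zero]
    have h := (hres.const_mul ε⁻¹).sqrt
    simpa [inv_mul_cancel_left₀ hε0.ne', Real.sqrt_sq (norm_nonneg _)] using h
  have hRcont : ContinuousOn R D :=
    (LipschitzOnWith.of_dist_le_mul (K := 1) fun a ha b hb => by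
      simpa [dist_eq_norm] using hR a ha b hb).continuousOn
  have hRs : Filter.Tendsto (fun k => R (x (s k))) Filter.atTop (nhds (R p)) :=
    (hRcont p hpD).tendsto.comp
      (tendsto_nhdsWithin_iff.2 ⟨hsp, .of_forall fun k => hxD _⟩)
  have hRp : R p = p := sub_eq_zero.1
    (tendsto_nhds_unique (hRs.sub hsp) (hres'.comp hs.tendsto_atTop))
  refine ⟨p, hpD, hRp, ?_⟩
  have hsub : Filter.Tendsto (fun k => ‖x (s k) - p‖ ^ 2 / ε) Filter.atTop (nhds 0) := by
    have h := ((tendsto_iff_norm_sub_tendsto_zero.1 hsp).pow 2).div_const ε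
    simpa using h
  have hV := (hquasi p hpD hRp).2.2 s hs (squeeze_zero
    (fun k => (sq_nonneg _).trans (hSlow (s k) _)) (fun k => hSup (s k) _) hsub)
  have hnorm := (squeeze_zero (fun k => sq_nonneg _) (fun k => hSlow k (x k - p)) hV).sqrt
  rw [tendsto_iff_norm_sub_tendsto_zero]
  simpa [Real.sqrt_sq (norm_nonneg _)] using hnorm
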